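/- arXiv:2004.01232 — 5 statements merged into one kernel-verified Lean document; each statement's English description precedes it below -/
import Mathlib

section
/- There exists a continuous function f : [0,∞) → [0,∞)^I such that for every w ≥ 0 one has θ·f(w) = w and C(f(w)) = inf{ C(q) : q ∈ [0,∞)^I, θ·q = w }. -/
open Filter Topology

/-- The nonnegative vectors `q` with `θ·q = w`. -/
def budgetSet {ι : Type*} [Fintype ι] (θ : ι → ℝ) (w : ℝ) : Set (ι → ℝ) :=
  {q | (∀ i, 0 ≤ q i) ∧ ∑ i, θ i * q i = w}

section BudgetSet

variable {ι : Type*} [Fintype ι] {θ : ι → ℝ}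

lemma convex_budgetSet (θ : ι → ℝ) (w : ℝ) : Convex ℝ (budgetSet θ w) := by
  rintro p ⟨hp, hpw⟩ q ⟨hq, hqw⟩ a b ha hb hab
  refine ⟨fun i => add_nonneg (mul_nonneg ha (hp i)) (mul_nonneg hb (hq i)), ?_⟩
  calc ∑ i, θ i * (a • p + b • q) i
      = a * ∑ i, θ i * p i + b * ∑ i, θ i * q i := by
        simp only [Finset.mul_sum, ← Finset.sum_add_distrib, Pi.add_apply, Pi.smul_apply,
          smul_eq_mul]
        exact Finset.sum_congr rfl fun i _ => by ring
    _ = w := by rw [hpw, hqw, ← add_mul, hab, one_mul]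

lemma isClosed_budgetSet (θ : ι → ℝ) (w : ℝ) : IsClosed (budgetSet θ w) := by
  have h₁ : IsClosed {q : ι → ℝ | ∀ i, 0 ≤ q i} := by
    simp only [Set.ofPred_forall]
    exact isClosed_iInter fun i => isClosed_le continuous_const (continuous_apply i)
  exact h₁.inter (isClosed_eq (by fun_prop) continuous_const)

lemma apply_le_of_mem_budgetSet (hθ : ∀ i, 0 < θ i) {w : ℝ} {q : ι → ℝ}
    (hq : q ∈ budgetSet θ w) (i : ι) : q i ≤ w / θ i := by
  rw [le_div_iff₀' (hθ i), ← hq.2]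
  exact Finset.single_le_sum (f := fun i => θ i * q i)
    (fun j _ => mul_nonneg (hθ j).le (hq.1 j)) (Finset.mem_univ i)

lemma budgetSet_subset_Icc (hθ : ∀ i, 0 < θ i) {w W : ℝ} (hw : w ≤ W) :
    budgetSet θ w ⊆ Set.Icc 0 fun i => W / θ i := fun _ hq =>
  ⟨hq.1, fun i => (apply_le_of_mem_budgetSet hθ hq i).trans
    (div_le_div_of_nonneg_right hw (hθ i).le)⟩

lemma isCompact_budgetSet (hθ : ∀ i, 0 < θ i) (w : ℝ) : IsCompact (budgetSet θ w) :=
  isCompact_Icc.of_isClosed_subset (isClosed_budgetSet θ w) (budgetSet_subset_Icc hθ le_rfl)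

lemma budgetSet_zero_subsingleton (hθ : ∀ i, 0 < θ i) : (budgetSet θ 0).Subsingleton := by
  have h : ∀ q ∈ budgetSet θ 0, q = 0 := fun q hq => funext fun i =>
    le_antisymm (by simpa using apply_le_of_mem_budgetSet hθ hq i) (hq.1 i)
  intro p hp q hq
  rw [h p hp, h q hq]

lemma smul_mem_budgetSet {w a : ℝ} (ha : 0 ≤ a) {q : ι → ℝ} (hq : q ∈ budgetSet θ w) :
    a • q ∈ budgetSet θ (a * w) := by
  refine ⟨fun i => mul_nonneg ha (hq.1 i), ?_⟩
  rw [← hq.2, Finset.mul_sum]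
  exact Finset.sum_congr rfl fun i _ => by simp only [Pi.smul_apply, smul_eq_mul]; ring

lemma budgetSet_nonempty [Nonempty ι] (hθ : ∀ i, 0 < θ i) {w : ℝ} (hw : 0 ≤ w) :
    (budgetSet θ w).Nonempty := by
  classical
  obtain ⟨i₀⟩ := ‹Nonempty ι›
  refine ⟨Pi.single i₀ (w / θ i₀), fun i => ?_, ?_⟩
  · exact (Pi.single_nonneg.2 (div_nonneg hw (hθ i₀).le) :
      (0 : ι → ℝ) ≤ Pi.single i₀ (w / θ i₀)) i
  · simp [Pi.single_apply, mul_div_cancel₀, (hθ i₀).ne']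

/-- Minimizers of a continuous function that is strictly convex on every budget set depend
continuously on the budget. -/
lemma continuousOn_of_isMinOn_budgetSet (hθ : ∀ i, 0 < θ i) {g : (ι → ℝ) → ℝ}
    (hg : Continuous g) (hconv : ∀ w, StrictConvexOn ℝ (budgetSet θ w) g) {f : ℝ → ι → ℝ}
    (hf : ∀ w, 0 ≤ w → f w ∈ budgetSet θ w)
    (hmin : ∀ w, 0 ≤ w → IsMinOn g (budgetSet θ w) (f w)) :
    ContinuousOn f (Set.Ici 0) := by
  intro w hw
  have hw : 0 ≤ w := hw
  have hcompact : IsCompact (Set.Icc (0 : ι → ℝ) fun i => (w + 1) / θ i) := isCompact_Icc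
  refine hcompact.tendsto_nhds_of_unique_mapClusterPt ?_ fun q _ hq => ?_
  · filter_upwards [self_mem_nhdsWithin,
      mem_nhdsWithin_of_mem_nhds (Iic_mem_nhds (lt_add_one w))] with v hv hv'
    exact budgetSet_subset_Icc hθ hv' (hf v hv)
  obtain ⟨U, hU, hlim⟩ := mapClusterPt_iff_ultrafilter.1 hq
  have hid : Tendsto id (U : Filter ℝ) (𝓝 w) := hU.trans nhdsWithin_le_nhds
  have hpos : ∀ᶠ v in (U : Filter ℝ), 0 ≤ v := hU self_mem_nhdsWithin
  have hqw : q ∈ budgetSet θ w := by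
    refine ⟨fun i => ge_of_tendsto (tendsto_pi_nhds.1 hlim i)
      (hpos.mono fun v hv => (hf v hv).1 i), ?_⟩
    refine tendsto_nhds_unique (tendsto_finsetSum _ fun i _ =>
      (tendsto_pi_nhds.1 hlim i).const_mul (θ i)) (hid.congr' ?_)
    exact hpos.mono fun v hv => (hf v hv).2.symm
  rcases hw.eq_or_lt with rfl | hw'
  · exact budgetSet_zero_subsingleton hθ hqw (hf 0 le_rfl)
  have hscale : Tendsto (fun v => g ((v / w) • f w)) (U : Filter ℝ) (𝓝 (g (f w))) := by
    have h : Tendsto (fun v => (v / w) • f w) (U : Filter ℝ) (𝓝 ((w / w) • f w)) :=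
      (hid.div_const w).smul_const (f w)
    rw [div_self hw'.ne', one_smul] at h
    exact (hg.tendsto _).comp h
  have hle : g q ≤ g (f w) := by
    refine le_of_tendsto_of_tendsto ((hg.tendsto q).comp hlim) hscale (hpos.mono fun v hv => ?_)
    have hmem := smul_mem_budgetSet (div_nonneg hv hw) (hf w hw)
    rw [div_mul_cancel₀ v hw'.ne'] at hmem
    exact hmin v hv hmem
  exact (hconv w).eq_of_isMinOn (fun p hp => hle.trans (hmin w hw hp)) (hmin w hw) hqw (hf w hw)

lemma strictConvexOn_sum_budgetSet {c : ι → ℝ → ℝ}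
    (hc : ∀ i, StrictConvexOn ℝ (Set.Ici 0) (c i)) (w : ℝ) :
    StrictConvexOn ℝ (budgetSet θ w) fun q => ∑ i, c i (q i) := by
  refine ⟨convex_budgetSet θ w, fun p hp q hq hpq a b ha hb hab => ?_⟩
  obtain ⟨i₀, hi₀⟩ := Function.ne_iff.1 hpq
  simp only [smul_eq_mul, Finset.mul_sum, ← Finset.sum_add_distrib]
  exact Finset.sum_lt_sum
    (fun i _ => (hc i).convexOn.2 (hp.1 i) (hq.1 i) ha.le hb.le hab)
    ⟨i₀, Finset.mem_univ _, (hc i₀).2 (hp.1 i₀) (hq.1 i₀) hi₀ ha hb hab⟩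

end BudgetSet


/-- Fix `I ≥ 1`, rates `μ i ∈ (0,∞)`, `θ i = 1/μ i`. Each `Cᵢ` is
strictly increasing, strictly convex, continuously differentiable on `[0,∞)` with
`Cᵢ(0) = Cᵢ'(0) = 0`, taking values in `[0,∞)`; `C x = ∑ i, Cᵢ (x i)`. Then there exists a
continuous `f : [0,∞) → [0,∞)^I` with `θ·f(w) = w` and
`C (f w) = inf { C q : q ∈ [0,∞)^I, θ·q = w }` for all `w ≥ 0`. -/
theorem minimizing_curve_exists
    (I : ℕ) (hI : 1 ≤ I) (μ : Fin I → ℝ) (hμ : ∀ i, 0 < μ i)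
    (θ : Fin I → ℝ) (hθ : ∀ i, θ i = (μ i)⁻¹)
    (Ci Ci' : Fin I → ℝ → ℝ)
    (hmono : ∀ i, StrictMonoOn (Ci i) (Set.Ici 0))
    (hconv : ∀ i, StrictConvexOn ℝ (Set.Ici 0) (Ci i))
    (hderiv : ∀ i, ∀ x ∈ Set.Ici (0 : ℝ), HasDerivWithinAt (Ci i) (Ci' i x) (Set.Ici 0) x)
    (hderivCont : ∀ i, ContinuousOn (Ci' i) (Set.Ici 0))
    (hCnonneg : ∀ i x, 0 ≤ x → 0 ≤ Ci i x)
    (hC0 : ∀ i, Ci i 0 = 0) (hC0' : ∀ i, Ci' i 0 = 0) :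
    ∃ f : ℝ → Fin I → ℝ,
      ContinuousOn f (Set.Ici 0) ∧
      ∀ w : ℝ, 0 ≤ w →
        (∀ i, 0 ≤ f w i) ∧
        (∑ i, θ i * f w i) = w ∧
        (∑ i, Ci i (f w i)) =
          sInf { c : ℝ | ∃ q : Fin I → ℝ, (∀ i, 0 ≤ q i) ∧ (∑ i, θ i * q i) = w ∧
            c = ∑ i, Ci i (q i) } := by
  have : Nonempty (Fin I) := ⟨⟨0, hI⟩⟩
  have hθpos : ∀ i, 0 < θ i := fun i => hθ i ▸ inv_pos.2 (hμ i)
  let g : (Fin I → ℝ) → ℝ := fun q => ∑ i, Ci i (max (q i) 0)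
  have hg : Continuous g := continuous_finsetSum _ fun i _ =>
    ContinuousOn.comp_continuous (fun x hx => (hderiv i x hx).continuousWithinAt)
      ((continuous_apply i).max continuous_const) fun q => le_max_right (q i) 0
  have hgeq : ∀ q : Fin I → ℝ, (∀ i, 0 ≤ q i) → g q = ∑ i, Ci i (q i) := fun q hq =>
    Finset.sum_congr rfl fun i _ => by rw [max_eq_left (hq i)]
  have hgconv : ∀ w, StrictConvexOn ℝ (budgetSet θ w) g := fun w =>
    (strictConvexOn_sum_budgetSet hconv w).congr fun q hq => (hgeq q hq.1).symm
  have hex : ∀ w : ℝ, ∃ q : Fin I → ℝ, 0 ≤ w →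
      q ∈ budgetSet θ w ∧ IsMinOn g (budgetSet θ w) q := fun w => by
    by_cases hw : 0 ≤ w
    · obtain ⟨q, hq, hmin⟩ := (isCompact_budgetSet hθpos w).exists_isMinOn
        (budgetSet_nonempty hθpos hw) hg.continuousOn
      exact ⟨q, fun _ => ⟨hq, hmin⟩⟩
    · exact ⟨0, fun h => absurd h hw⟩
  choose f hf using hex
  refine ⟨f, continuousOn_of_isMinOn_budgetSet hθpos hg hgconv (fun w hw => (hf w hw).1)
    fun w hw => (hf w hw).2, fun w hw => ?_⟩
  obtain ⟨hmem, hmin⟩ := hf w hw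
  refine ⟨hmem.1, hmem.2, (IsLeast.csInf_eq ?_).symm⟩
  refine ⟨⟨f w, hmem.1, hmem.2, rfl⟩, ?_⟩
  rintro _ ⟨q, hq, hqw, rfl⟩
  rw [← hgeq q hq, ← hgeq _ hmem.1]
  exact hmin ⟨hq, hqw⟩
end

section
/- Let w > 0 and let q* ∈ [0,∞)^I minimize C over {q ∈ [0,∞)^I : θ·q = w}. Then every coordinate of q* is strictly positive and the quantities μᵢ Cᵢ'(qᵢ*) are equal for all i ∈ {1,…,I}, i.e., μ₁C₁'(q₁*) = μ₂C₂'(q₂*) = … = μ_I C_I'(q_I*). -/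
/-- At a minimizer over a segment `q + [0, δ] • d` of the orthant, the derivative of a separable
cost in the direction `d` is nonnegative. -/
lemma sum_derivWithin_mul_nonneg_of_forall_le {ι : Type*} [Fintype ι] {f f' : ι → ℝ → ℝ}
    {q d : ι → ℝ} {δ : ℝ} (hδ : 0 < δ)
    (hf : ∀ i, HasDerivWithinAt (f i) (f' i (q i)) (Set.Ici 0) (q i))
    (hnonneg : ∀ t ∈ Set.Icc 0 δ, ∀ i, 0 ≤ q i + t * d i)
    (hmin : ∀ t ∈ Set.Icc 0 δ, ∑ i, f i (q i) ≤ ∑ i, f i (q i + t * d i)) :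
    0 ≤ ∑ i, f' i (q i) * d i := by
  have hg : HasDerivWithinAt (fun t : ℝ ↦ ∑ i, f i (q i + t * d i))
      (∑ i, f' i (q i) * d i) (Set.Icc 0 δ) 0 := by
    refine HasDerivWithinAt.fun_sum fun i _ ↦ ?_
    have hline : HasDerivWithinAt (fun t : ℝ ↦ q i + t * d i) (d i) (Set.Icc 0 δ) 0 := by
      simpa using (((hasDerivAt_id (0 : ℝ)).mul_const (d i)).const_add (q i)).hasDerivWithinAt
    have hfi : HasDerivWithinAt (f i) (f' i (q i)) (Set.Ici 0) (q i + 0 * d i) := by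
      simpa using hf i
    exact hfi.comp 0 hline fun t ht ↦ hnonneg t ht i
  have hgt := (hasDerivWithinAt_iff_tendsto_slope' (by simp)).1 (hg.mono Set.Ioc_subset_Icc_self)
  have : (nhdsWithin (0 : ℝ) (Set.Ioc 0 δ)).NeBot := by
    rw [nhdsWithin_Ioc_eq_nhdsGT hδ]
    infer_instance
  refine ge_of_tendsto hgt ?_
  filter_upwards [self_mem_nhdsWithin] with t ht
  rw [slope_def_field]
  refine div_nonneg (sub_nonneg.2 ?_) (by simpa using ht.1.le)
  simpa using hmin t (Set.Ioc_subset_Icc_self ht)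


/-- In the setup of the minimizing curve, let `w > 0` and let
`q* ∈ [0,∞)^I` minimize `C` over `{q ∈ [0,∞)^I : θ·q = w}`. Then every coordinate of `q*`
is strictly positive and `μ₁C₁'(q₁*) = ⋯ = μ_I C_I'(q_I*)`. -/
theorem constrained_minimizer_first_order
    (I : ℕ) (hI : 1 ≤ I) (μ : Fin I → ℝ) (hμ : ∀ i, 0 < μ i)
    (θ : Fin I → ℝ) (hθ : ∀ i, θ i = (μ i)⁻¹)
    (Ci Ci' : Fin I → ℝ → ℝ)
    (hmono : ∀ i, StrictMonoOn (Ci i) (Set.Ici 0))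
    (hconv : ∀ i, StrictConvexOn ℝ (Set.Ici 0) (Ci i))
    (hderiv : ∀ i, ∀ x ∈ Set.Ici (0 : ℝ), HasDerivWithinAt (Ci i) (Ci' i x) (Set.Ici 0) x)
    (hderivCont : ∀ i, ContinuousOn (Ci' i) (Set.Ici 0))
    (hCnonneg : ∀ i x, 0 ≤ x → 0 ≤ Ci i x)
    (hC0 : ∀ i, Ci i 0 = 0) (hC0' : ∀ i, Ci' i 0 = 0)
    (w : ℝ) (hw : 0 < w)
    (qstar : Fin I → ℝ) (hq_nonneg : ∀ i, 0 ≤ qstar i)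
    (hq_feas : (∑ i, θ i * qstar i) = w)
    (hq_min : ∀ q : Fin I → ℝ, (∀ i, 0 ≤ q i) → (∑ i, θ i * q i) = w →
      (∑ i, Ci i (qstar i)) ≤ ∑ i, Ci i (q i)) :
    (∀ i, 0 < qstar i) ∧
    (∀ i j, μ i * Ci' i (qstar i) = μ j * Ci' j (qstar j)) := by
  have transfer_le {i j : Fin I} (hj : 0 < qstar j) :
      μ j * Ci' j (qstar j) ≤ μ i * Ci' i (qstar i) := by
    rcases eq_or_ne i j with rfl | hij
    · rfl
    have hθμ (k : Fin I) : θ k * μ k = 1 := by rw [hθ, inv_mul_cancel₀ (hμ k).ne']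
    let d : Fin I → ℝ := Pi.single i (μ i) - Pi.single j (μ j)
    have hsum (a : Fin I → ℝ) : ∑ k, a k * d k = a i * μ i - a j * μ j := by
      simp [d, mul_sub, Finset.sum_sub_distrib, Pi.single_apply]
    have hnonneg : ∀ t ∈ Set.Icc 0 (qstar j / μ j), ∀ k, 0 ≤ qstar k + t * d k := by
      rintro t ⟨ht0, ht⟩ k
      rw [le_div_iff₀ (hμ j)] at ht
      rcases eq_or_ne k j with rfl | hkj
      · simpa [d, hij.symm] using ht
      · have hd : 0 ≤ d k := by
          rcases eq_or_ne k i with rfl | hki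
          · simp [d, hkj, (hμ k).le]
          · simp [d, hkj, hki]
        exact add_nonneg (hq_nonneg k) (mul_nonneg ht0 hd)
    have hdir : 0 ≤ ∑ k, Ci' k (qstar k) * d k :=
      sum_derivWithin_mul_nonneg_of_forall_le (div_pos hj (hμ j))
        (fun k ↦ hderiv k _ (hq_nonneg k)) hnonneg fun t ht ↦ by
          refine hq_min _ (hnonneg t ht) ?_
          have hzero : ∑ k, θ k * d k = 0 := by rw [hsum, hθμ, hθμ, sub_self]
          simp only [mul_add, Finset.sum_add_distrib, mul_left_comm _ t, ← Finset.mul_sum,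
            hq_feas, hzero, mul_zero, add_zero]
    rw [hsum fun k ↦ Ci' k (qstar k)] at hdir
    linarith
  have hderiv_pos {j : Fin I} (hj : 0 < qstar j) : 0 < Ci' j (qstar j) := by
    have hslope : 0 < slope (Ci j) 0 (qstar j) := by
      rw [slope_def_field]
      exact div_pos (sub_pos.2 (hmono j Set.self_mem_Ici hj.le hj)) (by simpa using hj)
    exact hslope.trans_le ((hconv j).convexOn.slope_le_of_hasDerivWithinAt
      Set.self_mem_Ici hj.le hj (hderiv j _ hj.le))
  have hpos (i : Fin I) : 0 < qstar i := by
    obtain ⟨j, hj⟩ : ∃ j, 0 < qstar j := by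
      by_contra! h
      have hq : ∀ k, qstar k = 0 := fun k ↦ (h k).antisymm (hq_nonneg k)
      simp only [hq, mul_zero, Finset.sum_const_zero] at hq_feas
      exact hw.ne hq_feas
    refine (hq_nonneg i).lt_of_ne' fun hi ↦ ?_
    have hle := transfer_le (i := i) hj
    rw [hi, hC0', mul_zero] at hle
    exact hle.not_gt (mul_pos (hμ j) (hderiv_pos hj))
  exact ⟨hpos, fun i j ↦ (transfer_le (hpos i)).antisymm (transfer_le (hpos j))⟩
end

section
/- Let f : [0,∞) → [0,∞)^I be a function such that for every w ≥ 0, θ·f(w) = w and C(f(w)) = inf{ C(q) : q ∈ [0,∞)^I, θ·q = w }. Then for each i ∈ {1,…,I} the map w ↦ Cᵢ(fᵢ(w)) is strictly increasing on [0,∞). -/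
theorem StrictConvexOn.strictMonoOn_of_hasDerivWithinAt {S : Set ℝ} {g g' : ℝ → ℝ}
    (hg : StrictConvexOn ℝ S g) (hg' : ∀ x ∈ S, HasDerivWithinAt g (g' x) S x) :
    StrictMonoOn g' S := fun x hx y hy hxy =>
  (hg.lt_slope_of_hasDerivWithinAt hx hy hxy (hg' x hx)).trans
    (hg.slope_lt_of_hasDerivWithinAt hx hy hxy (hg' y hy))

theorem sum_apply_update_update {ι : Type*} [Fintype ι] [DecidableEq ι] (g : ι → ℝ → ℝ)
    (x : ι → ℝ) {i j : ι} (hij : i ≠ j) (a b : ℝ) :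
    ∑ k, g k (Function.update (Function.update x i a) j b k) =
      ∑ k, g k (x k) + (g i a - g i (x i)) + (g j b - g j (x j)) := by
  have h : ∑ k, (g k (Function.update (Function.update x i a) j b k) - g k (x k)) =
      (g i a - g i (x i)) + (g j b - g j (x j)) := by
    rw [Finset.sum_eq_add i j hij (fun k _ hk => by simp [hk.1, hk.2]) (by simp) (by simp)]
    simp [hij]
  rw [Finset.sum_sub_distrib] at h
  linarith

/-- A differentiable function on `[0, b]` that is minimal at `0` has nonnegative derivative there. -/
theorem HasDerivWithinAt.nonneg_of_isMinOn_Icc {φ : ℝ → ℝ} {d b : ℝ} (hb : 0 < b)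
    (hφ : HasDerivWithinAt φ d (Set.Icc 0 b) 0) (hmin : IsMinOn φ (Set.Icc 0 b) 0) : 0 ≤ d := by
  have hd : b ∈ posTangentConeAt (Set.Icc 0 b) 0 :=
    mem_posTangentConeAt_of_segment_subset (by simp [segment_eq_Icc hb.le])
  have h := hmin.localize.hasFDerivWithinAt_nonneg hφ.hasFDerivWithinAt hd
  simp only [ContinuousLinearMap.toSpanSingleton_apply, smul_eq_mul] at h
  exact nonneg_of_mul_nonneg_right h hb

/-- First-order condition for a separable cost minimized over the nonnegative solutions of
`∑ k, θ k * q k = w`: shifting workload from class `j` to class `i` cannot decrease the cost. -/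
theorem mul_deriv_le_mul_deriv_of_isMinOn_workload {ι : Type*} [Fintype ι] {θ : ι → ℝ}
    (hθ : ∀ i, 0 < θ i) {c c' : ι → ℝ → ℝ}
    (hc : ∀ i, ∀ x ∈ Set.Ici (0 : ℝ), HasDerivWithinAt (c i) (c' i x) (Set.Ici 0) x)
    {x : ι → ℝ} (hx : ∀ i, 0 ≤ x i)
    (hmin : ∀ q : ι → ℝ, (∀ i, 0 ≤ q i) → ∑ i, θ i * q i = ∑ i, θ i * x i →
      ∑ i, c i (x i) ≤ ∑ i, c i (q i))
    (i j : ι) (hj : 0 < x j) : θ i * c' j (x j) ≤ θ j * c' i (x i) := by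
  classical
  rcases eq_or_ne i j with rfl | hij
  · exact le_rfl
  have hb : 0 < x j / θ i := div_pos hj (hθ i)
  have hmaps_i : Set.MapsTo (fun t => x i + t * θ j) (Set.Icc 0 (x j / θ i)) (Set.Ici 0) :=
    fun t ht => add_nonneg (hx i) (mul_nonneg ht.1 (hθ j).le)
  have hmaps_j : Set.MapsTo (fun t => x j - t * θ i) (Set.Icc 0 (x j / θ i)) (Set.Ici 0) :=
    fun t ht => sub_nonneg.2 ((le_div_iff₀ (hθ i)).1 ht.2)
  have hder_i : HasDerivWithinAt (fun t => c i (x i + t * θ j)) (c' i (x i) * θ j)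
      (Set.Icc 0 (x j / θ i)) 0 := by
    have h : HasDerivAt (fun t : ℝ => x i + t * θ j) (θ j) 0 := by
      simpa using ((hasDerivAt_id (0 : ℝ)).mul_const (θ j)).const_add (x i)
    exact HasDerivWithinAt.comp_of_eq 0 (hc i (x i) (hx i)) h.hasDerivWithinAt hmaps_i (by simp)
  have hder_j : HasDerivWithinAt (fun t => c j (x j - t * θ i)) (c' j (x j) * -θ i)
      (Set.Icc 0 (x j / θ i)) 0 := by
    have h : HasDerivAt (fun t : ℝ => x j - t * θ i) (-θ i) 0 := by
      simpa using ((hasDerivAt_id (0 : ℝ)).mul_const (θ i)).const_sub (x j)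
    exact HasDerivWithinAt.comp_of_eq 0 (hc j (x j) (hx j)) h.hasDerivWithinAt hmaps_j (by simp)
  have h := (hder_i.add hder_j).nonneg_of_isMinOn_Icc hb fun t ht => by
    have hq := hmin (Function.update (Function.update x i (x i + t * θ j)) j (x j - t * θ i))
      (fun k => by
        rcases eq_or_ne k j with rfl | hkj
        · simpa using hmaps_j ht
        rcases eq_or_ne k i with rfl | hki
        · simpa [hkj] using hmaps_i ht
        · simpa [hkj, hki] using hx k)
      (by rw [sum_apply_update_update (fun k y => θ k * y) x hij]; ring)
    rw [sum_apply_update_update c x hij] at hq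
    simp only [Set.mem_ofPred_eq, Pi.add_apply, zero_mul, add_zero, sub_zero]
    linarith
  linarith

/-- In the setup of the minimizing curve, let `f : [0,∞) → [0,∞)^I`
satisfy `θ·f(w) = w` and `C(f(w)) = inf { C q : q ∈ [0,∞)^I, θ·q = w }` for every `w ≥ 0`.
Then for each `i` the map `w ↦ Cᵢ(fᵢ(w))` is strictly increasing on `[0,∞)`. -/
theorem minimizing_curve_cost_strictMono
    (I : ℕ) (hI : 1 ≤ I) (μ : Fin I → ℝ) (hμ : ∀ i, 0 < μ i)
    (θ : Fin I → ℝ) (hθ : ∀ i, θ i = (μ i)⁻¹)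
    (Ci Ci' : Fin I → ℝ → ℝ)
    (hmono : ∀ i, StrictMonoOn (Ci i) (Set.Ici 0))
    (hconv : ∀ i, StrictConvexOn ℝ (Set.Ici 0) (Ci i))
    (hderiv : ∀ i, ∀ x ∈ Set.Ici (0 : ℝ), HasDerivWithinAt (Ci i) (Ci' i x) (Set.Ici 0) x)
    (hderivCont : ∀ i, ContinuousOn (Ci' i) (Set.Ici 0))
    (hCnonneg : ∀ i x, 0 ≤ x → 0 ≤ Ci i x)
    (hC0 : ∀ i, Ci i 0 = 0) (hC0' : ∀ i, Ci' i 0 = 0)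
    (f : ℝ → Fin I → ℝ)
    (hf_nonneg : ∀ w : ℝ, 0 ≤ w → ∀ i, 0 ≤ f w i)
    (hf_feas : ∀ w : ℝ, 0 ≤ w → (∑ i, θ i * f w i) = w)
    (hf_min : ∀ w : ℝ, 0 ≤ w →
      (∑ i, Ci i (f w i)) =
        sInf { c : ℝ | ∃ q : Fin I → ℝ, (∀ i, 0 ≤ q i) ∧ (∑ i, θ i * q i) = w ∧
          c = ∑ i, Ci i (q i) }) :
    ∀ i, StrictMonoOn (fun w => Ci i (f w i)) (Set.Ici 0) := by
  have hθpos : ∀ i, 0 < θ i := fun i => hθ i ▸ inv_pos.2 (hμ i)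
  have hderivMono : ∀ i, StrictMonoOn (Ci' i) (Set.Ici 0) := fun i =>
    (hconv i).strictMonoOn_of_hasDerivWithinAt (hderiv i)
  have hle : ∀ w, 0 ≤ w → ∀ i j, θ i * Ci' j (f w j) ≤ θ j * Ci' i (f w i) := by
    intro w hw i j
    rcases (hf_nonneg w hw j).eq_or_lt with h0 | hpos
    · rw [← h0, hC0' j, mul_zero]
      refine mul_nonneg (hθpos j).le ?_
      rw [← hC0' i]
      exact (hderivMono i).monotoneOn Set.self_mem_Ici (hf_nonneg w hw i) (hf_nonneg w hw i)
    · refine mul_deriv_le_mul_deriv_of_isMinOn_workload hθpos hderiv (hf_nonneg w hw) ?_ i j hpos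
      intro q hq hqw
      rw [hf_min w hw]
      refine csInf_le ⟨0, ?_⟩ ⟨q, hq, hqw.trans (hf_feas w hw), rfl⟩
      rintro _ ⟨p, hp, -, rfl⟩
      exact Finset.sum_nonneg fun k _ => hCnonneg k _ (hp k)
  intro i w hw v hv hwv
  obtain ⟨j, -, hj⟩ : ∃ j ∈ Finset.univ, θ j * f w j < θ j * f v j :=
    Finset.exists_lt_of_sum_lt (by rwa [hf_feas w hw, hf_feas v hv])
  have hj' := hderivMono j (hf_nonneg w hw j) (hf_nonneg v hv j)
    (lt_of_mul_lt_mul_left hj (hθpos j).le)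
  have hi : Ci' i (f w i) < Ci' i (f v i) := by
    refine lt_of_mul_lt_mul_left ?_ (hθpos j).le
    calc θ j * Ci' i (f w i) ≤ θ i * Ci' j (f w j) := hle w hw j i
      _ < θ i * Ci' j (f v j) := mul_lt_mul_of_pos_left hj' (hθpos i)
      _ ≤ θ j * Ci' i (f v i) := hle v hv i j
  exact hmono i (hf_nonneg w hw i) (hf_nonneg v hv i)
    (((hderivMono i).lt_iff_lt (hf_nonneg w hw i) (hf_nonneg v hv i)).1 hi)
end

section
/- Let l₁, l₂ : [0,∞) → ℝ be bounded on every compact interval. Then for every t ≥ 0, sup_{0≤s≤t} |Γ[l₁](s) − Γ[l₂](s)| ≤ 2 · sup_{0≤s≤t} |l₁(s) − l₂(s)|, i.e., ‖Γ[l₁]−Γ[l₂]‖_t ≤ 2‖l₁−l₂‖_t. -/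
/-- The one-dimensional Skorokhod map:
`Γ[l](t) = l(t) − inf { l(s) ∧ 0 : s ∈ [0,t] }`. -/
noncomputable def skorokhod (l : ℝ → ℝ) (t : ℝ) : ℝ :=
  l t - sInf ((fun s => min (l s) 0) '' Set.Icc 0 t)

theorem sInf_image_min_zero_le_add {l₁ l₂ : ℝ → ℝ} {S : Set ℝ} {d : ℝ} (hS : S.Nonempty)
    (hbdd : ∃ M, ∀ s ∈ S, |l₁ s| ≤ M) (hd : ∀ s ∈ S, |l₁ s - l₂ s| ≤ d) :
    sInf ((fun s => min (l₁ s) 0) '' S) ≤ sInf ((fun s => min (l₂ s) 0) '' S) + d := by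
  rw [← sub_le_iff_le_add]
  apply le_csInf (hS.image _)
  rintro _ ⟨s, hs, rfl⟩
  have hbelow : BddBelow ((fun s => min (l₁ s) 0) '' S) := by
    obtain ⟨M, hM⟩ := hbdd
    refine ⟨-M, ?_⟩
    rintro _ ⟨u, hu, rfl⟩
    have h := hM u hu
    exact le_min (abs_le.1 h).1 (by linarith [abs_nonneg (l₁ u)])
  have hle := csInf_le hbelow (Set.mem_image_of_mem (fun s => min (l₁ s) 0) hs)
  have hmin := (le_abs_self _).trans (abs_min_sub_min_le_max (l₁ s) 0 (l₂ s) 0)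
  have hmax : max |l₁ s - l₂ s| |(0 : ℝ) - 0| ≤ d :=
    max_le (hd s hs) (by simpa using (abs_nonneg _).trans (hd s hs))
  dsimp only at hle ⊢
  linarith

/-- Let `l₁, l₂ : [0,∞) → ℝ` be bounded on every compact interval. Then for
every `t ≥ 0`, `sup_{0 ≤ s ≤ t} |Γ[l₁](s) − Γ[l₂](s)| ≤ 2 · sup_{0 ≤ s ≤ t} |l₁(s) − l₂(s)|`. -/
theorem skorokhod_lipschitz
    (l₁ l₂ : ℝ → ℝ)
    (hl₁_bdd : ∀ T : ℝ, ∃ M : ℝ, ∀ t ∈ Set.Icc (0 : ℝ) T, |l₁ t| ≤ M)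
    (hl₂_bdd : ∀ T : ℝ, ∃ M : ℝ, ∀ t ∈ Set.Icc (0 : ℝ) T, |l₂ t| ≤ M) :
    ∀ t : ℝ, 0 ≤ t →
      sSup ((fun s => |skorokhod l₁ s - skorokhod l₂ s|) '' Set.Icc 0 t) ≤
        2 * sSup ((fun s => |l₁ s - l₂ s|) '' Set.Icc 0 t) := by
  intro t ht
  set d := sSup ((fun s => |l₁ s - l₂ s|) '' Set.Icc 0 t)
  have hd : ∀ s ∈ Set.Icc 0 t, |l₁ s - l₂ s| ≤ d := by
    obtain ⟨M₁, hM₁⟩ := hl₁_bdd t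
    obtain ⟨M₂, hM₂⟩ := hl₂_bdd t
    intro s hs
    refine le_csSup ⟨M₁ + M₂, ?_⟩ (Set.mem_image_of_mem (fun s => |l₁ s - l₂ s|) hs)
    rintro _ ⟨u, hu, rfl⟩
    exact (abs_sub _ _).trans (add_le_add (hM₁ u hu) (hM₂ u hu))
  apply csSup_le ((Set.nonempty_Icc.2 ht).image _)
  rintro _ ⟨s, hs, rfl⟩
  have hds : ∀ u ∈ Set.Icc 0 s, |l₁ u - l₂ u| ≤ d := fun u hu => hd u ⟨hu.1, hu.2.trans hs.2⟩
  have hne : (Set.Icc 0 s).Nonempty := Set.nonempty_Icc.2 hs.1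
  have h₁ := sInf_image_min_zero_le_add hne (hl₁_bdd s) hds
  have h₂ := sInf_image_min_zero_le_add hne (hl₂_bdd s)
    (fun u hu => (abs_sub_comm _ _).trans_le (hds u hu))
  have h := abs_le.1 (hd s hs)
  simp only [skorokhod]
  exact abs_le.2 ⟨by linarith, by linarith⟩
end

section
/- Let L : [0,∞) → ℝ^I be continuous and let Y : [0,∞) → ℝ^I be such that the scalar function t ↦ θ·Y(t) is nonnegative and nondecreasing and such that X(t) := L(t) + Y(t) lies in [0,∞)^I for every t ≥ 0. Let f : [0,∞) → [0,∞)^I satisfy, for every w ≥ 0, θ·f(w) = w and C(f(w)) = inf{ C(q) : q ∈ [0,∞)^I, θ·q = w }. Then for every t ≥ 0: (i) θ·X(t) ≥ Γ[θ·L](t), and (ii) C(f(Γ[θ·L](t))) ≤ C(X(t)). -/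
/-- If `l` lies above `-a` on `[0,t]`, with `a ≥ 0`, then `Γ[l](t)` lies between `0` and
`l(t) + a`. -/
theorem skorokhod_mem_Icc {l : ℝ → ℝ} {a t : ℝ} (ht : 0 ≤ t) (ha : 0 ≤ a)
    (hl : ∀ s ∈ Set.Icc 0 t, -a ≤ l s) : skorokhod l t ∈ Set.Icc 0 (l t + a) := by
  have hlow : -a ∈ lowerBounds ((fun s => min (l s) 0) '' Set.Icc 0 t) := by
    rintro _ ⟨s, hs, rfl⟩
    exact le_min (hl s hs) (by linarith)
  have htm : t ∈ Set.Icc 0 t := ⟨ht, le_rfl⟩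
  have hle : sInf ((fun s => min (l s) 0) '' Set.Icc 0 t) ≤ min (l t) 0 :=
    csInf_le ⟨-a, hlow⟩ ⟨t, htm, rfl⟩
  have hge : -a ≤ sInf ((fun s => min (l s) 0) '' Set.Icc 0 t) :=
    le_csInf ⟨_, t, htm, rfl⟩ hlow
  have hmin := min_le_left (l t) 0
  simp only [skorokhod, Set.mem_Icc]
  constructor <;> linarith

/-- Scaling down a nonnegative vector reaches every smaller nonnegative workload without
increasing any coordinate. -/
theorem exists_le_sum_mul_eq {ι : Type*} [Fintype ι] {θ x : ι → ℝ} (hx : ∀ i, 0 ≤ x i) {w : ℝ}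
    (hw : 0 ≤ w) (hwx : w ≤ ∑ i, θ i * x i) :
    ∃ q : ι → ℝ, (∀ i, 0 ≤ q i) ∧ (∀ i, q i ≤ x i) ∧ ∑ i, θ i * q i = w := by
  set W := ∑ i, θ i * x i with hW
  refine ⟨fun i => w / W * x i, fun i => mul_nonneg (div_nonneg hw (hw.trans hwx)) (hx i),
    fun i => mul_le_of_le_one_left (hx i) (div_le_one_of_le₀ hwx (hw.trans hwx)), ?_⟩
  simp only [mul_left_comm (θ _) (w / W), ← Finset.mul_sum, ← hW]
  exact div_mul_cancel_of_imp fun h => le_antisymm (h ▸ hwx) hw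

/-- In the setup of the minimizing curve, let `L : [0,∞) → ℝ^I` be
continuous and let `Y : [0,∞) → ℝ^I` be such that `t ↦ θ·Y(t)` is nonnegative and
nondecreasing, and `X(t) := L(t) + Y(t) ∈ [0,∞)^I` for all `t ≥ 0`. Let `f` satisfy
`θ·f(w) = w` and `C(f(w)) = inf { C q : q ∈ [0,∞)^I, θ·q = w }` for every `w ≥ 0`. Then
for every `t ≥ 0`: (i) `θ·X(t) ≥ Γ[θ·L](t)`, and (ii) `C(f(Γ[θ·L](t))) ≤ C(X(t))`. -/
theorem skorokhod_pathwise_cost_bound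
    (I : ℕ) (hI : 1 ≤ I) (μ : Fin I → ℝ) (hμ : ∀ i, 0 < μ i)
    (θ : Fin I → ℝ) (hθ : ∀ i, θ i = (μ i)⁻¹)
    (Ci Ci' : Fin I → ℝ → ℝ)
    (hmono : ∀ i, StrictMonoOn (Ci i) (Set.Ici 0))
    (hconv : ∀ i, StrictConvexOn ℝ (Set.Ici 0) (Ci i))
    (hderiv : ∀ i, ∀ x ∈ Set.Ici (0 : ℝ), HasDerivWithinAt (Ci i) (Ci' i x) (Set.Ici 0) x)
    (hderivCont : ∀ i, ContinuousOn (Ci' i) (Set.Ici 0))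
    (hCnonneg : ∀ i x, 0 ≤ x → 0 ≤ Ci i x)
    (hC0 : ∀ i, Ci i 0 = 0) (hC0' : ∀ i, Ci' i 0 = 0)
    (L Y X : ℝ → Fin I → ℝ)
    (hL_cont : ContinuousOn L (Set.Ici 0))
    (hY_nonneg : ∀ t : ℝ, 0 ≤ t → 0 ≤ ∑ i, θ i * Y t i)
    (hY_mono : ∀ s t : ℝ, 0 ≤ s → s ≤ t → (∑ i, θ i * Y s i) ≤ ∑ i, θ i * Y t i)
    (hX_def : ∀ t : ℝ, 0 ≤ t → X t = L t + Y t)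
    (hX_nonneg : ∀ t : ℝ, 0 ≤ t → ∀ i, 0 ≤ X t i)
    (f : ℝ → Fin I → ℝ)
    (hf_nonneg : ∀ w : ℝ, 0 ≤ w → ∀ i, 0 ≤ f w i)
    (hf_feas : ∀ w : ℝ, 0 ≤ w → (∑ i, θ i * f w i) = w)
    (hf_min : ∀ w : ℝ, 0 ≤ w →
      (∑ i, Ci i (f w i)) =
        sInf { c : ℝ | ∃ q : Fin I → ℝ, (∀ i, 0 ≤ q i) ∧ (∑ i, θ i * q i) = w ∧
          c = ∑ i, Ci i (q i) }) :
    ∀ t : ℝ, 0 ≤ t →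
      skorokhod (fun s => ∑ i, θ i * L s i) t ≤ ∑ i, θ i * X t i ∧
      (∑ i, Ci i (f (skorokhod (fun s => ∑ i, θ i * L s i) t) i)) ≤ ∑ i, Ci i (X t i) := by
  intro t ht
  have hsum (s : ℝ) (hs : 0 ≤ s) :
      ∑ i, θ i * X s i = ∑ i, θ i * L s i + ∑ i, θ i * Y s i := by
    simp [hX_def s hs, mul_add, Finset.sum_add_distrib]
  have hθ_nonneg (i : Fin I) : 0 ≤ θ i := by
    rw [hθ]
    exact (inv_pos.2 (hμ i)).le
  have hL_low : ∀ s ∈ Set.Icc 0 t, -(∑ i, θ i * Y t i) ≤ ∑ i, θ i * L s i := by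
    intro s hs
    have hX : 0 ≤ ∑ i, θ i * X s i :=
      Finset.sum_nonneg fun i _ => mul_nonneg (hθ_nonneg i) (hX_nonneg s hs.1 i)
    linarith [hsum s hs.1, hY_mono s t hs.1 hs.2]
  obtain ⟨hw, hwX⟩ := skorokhod_mem_Icc ht (hY_nonneg t ht) hL_low
  rw [← hsum t ht] at hwX
  refine ⟨hwX, ?_⟩
  obtain ⟨q, hq, hqX, hqw⟩ := exists_le_sum_mul_eq (hX_nonneg t ht) hw hwX
  rw [hf_min _ hw]
  refine le_trans (b := ∑ i, Ci i (q i)) (csInf_le ⟨0, ?_⟩ ⟨q, hq, hqw, rfl⟩)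
    (Finset.sum_le_sum fun i _ => (hmono i).monotoneOn (hq i) (hX_nonneg t ht i) (hqX i))
  rintro _ ⟨p, hp, -, rfl⟩
  exact Finset.sum_nonneg fun i _ => hCnonneg i _ (hp i)
end
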